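/- (Theorem 2(i), uniqueness for λ = 0) Let A ⊆ ℝⁿ be a bounded closed set with 0 ∈ A ⊆ B₁, Ω := ℝⁿ \ A, and let g : ∂Ω → ℝ be continuous. If u and v are both continuous on the closure of Ω, infinity harmonic in Ω, equal to g on ∂Ω, and each of u and v attains both its maximum and its minimum over the closure of Ω on ∂Ω (i.e. min_{∂Ω} g ≤ u, v ≤ max_{∂Ω} g in Ω), then u = v in Ω. -/

import Mathlib

open Metric Set Filter Bornology Topology
open scoped RealInnerProductSpace

noncomputable section

/-- Euclidean space ℝⁿ. -/
abbrev Euc (n : ℕ) := EuclideanSpace ℝ (Fin n)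

/-- Comparison with cones from above (infinity subharmonic). -/
def CmpAbove {n : ℕ} (Ω : Set (Euc n)) (u : Euc n → ℝ) : Prop :=
  ∀ V : Set (Euc n), IsOpen V → IsBounded V → closure V ⊆ Ω →
    ∀ (x₀ : Euc n) (a b : ℝ),
      (∀ x ∈ frontier (V \ {x₀}), u x ≤ a * ‖x - x₀‖ + b) →
      ∀ x ∈ V, u x ≤ a * ‖x - x₀‖ + b

/-- Comparison with cones from below (infinity superharmonic). -/
def CmpBelow {n : ℕ} (Ω : Set (Euc n)) (u : Euc n → ℝ) : Prop :=
  ∀ V : Set (Euc n), IsOpen V → IsBounded V → closure V ⊆ Ω →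
    ∀ (x₀ : Euc n) (a b : ℝ),
      (∀ x ∈ frontier (V \ {x₀}), a * ‖x - x₀‖ + b ≤ u x) →
      ∀ x ∈ V, a * ‖x - x₀‖ + b ≤ u x

/-- Infinity harmonic = comparison with cones from both sides. -/
def InfHarmonic {n : ℕ} (Ω : Set (Euc n)) (u : Euc n → ℝ) : Prop :=
  CmpAbove Ω u ∧ CmpBelow Ω u

/-- m⁺ = max of u on ∂Ω. -/
def mP {n : ℕ} (Ω : Set (Euc n)) (u : Euc n → ℝ) : ℝ := sSup (u '' frontier Ω)

/-- m⁻ = min of u on ∂Ω. -/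
def mM {n : ℕ} (Ω : Set (Euc n)) (u : Euc n → ℝ) : ℝ := sInf (u '' frontier Ω)

/-- S⁺_r := (max(max_{∂B_r} u, m⁺) − m⁺)/r. -/
def SP {n : ℕ} (Ω : Set (Euc n)) (u : Euc n → ℝ) (r : ℝ) : ℝ :=
  (max (sSup (u '' sphere (0 : Euc n) r)) (mP Ω u) - mP Ω u) / r

/-- S⁻_r := (m⁻ − min(min_{∂B_r} u, m⁻))/r. -/
def SM {n : ℕ} (Ω : Set (Euc n)) (u : Euc n → ℝ) (r : ℝ) : ℝ :=
  (mM Ω u - min (sInf (u '' sphere (0 : Euc n) r)) (mM Ω u)) / r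

/-- Lip(u, S) := sup_{x≠y ∈ S} |u(x) − u(y)|/|x − y|. -/
def lipOn {n : ℕ} (u : Euc n → ℝ) (S : Set (Euc n)) : ℝ :=
  sSup ((fun p : Euc n × Euc n => |u p.1 - u p.2| / ‖p.1 - p.2‖) ''
    {p : Euc n × Euc n | p.1 ∈ S ∧ p.2 ∈ S ∧ p.1 ≠ p.2})

/-- `CostBound R I V c x t` says that some finite `R`-chain from `x` out of `I` satisfies
`V xᵢ + i * c ≤ t` at its `i`-th point, for every `i`. -/
inductive CostBound {α : Type*} (R : α → α → Prop) (I : Set α) (V : α → ℝ) (c : ℝ) :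
    α → ℝ → Prop
  | base {x : α} {t : ℝ} : x ∉ I → V x ≤ t → CostBound R I V c x t
  | step {x y : α} {s t : ℝ} : R x y → CostBound R I V c y s → V x ≤ t → s + c ≤ t →
      CostBound R I V c x t

namespace CostBound

variable {α : Type*} {R : α → α → Prop} {I : Set α} {V : α → ℝ} {c : ℝ} {x y : α}

lemma le {t : ℝ} (h : CostBound R I V c x t) : V x ≤ t := by
  cases h <;> assumption

/-- The infimum of the numbers `t` with `CostBound R I V c x t`. -/
def value (R : α → α → Prop) (I : Set α) (V : α → ℝ) (c : ℝ) (x : α) : ℝ :=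
  sInf {t | CostBound R I V c x t}

lemma bddBelow : BddBelow {t | CostBound R I V c x t} := ⟨V x, fun _ h => h.le⟩

lemma value_le {t : ℝ} (h : CostBound R I V c x t) : value R I V c x ≤ t :=
  csInf_le bddBelow h

lemma le_value (h : ∃ t, CostBound R I V c x t) : V x ≤ value R I V c x :=
  le_csInf h fun _ h => h.le

lemma exists_lt_value_add {δ : ℝ} (h : ∃ t, CostBound R I V c x t) (hδ : 0 < δ) :
    ∃ t, CostBound R I V c x t ∧ t < value R I V c x + δ :=
  exists_lt_of_csInf_lt h (lt_add_of_pos_right _ hδ)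

lemma value_le_max (h : ∃ t, CostBound R I V c x t) (hyx : R y x) :
    value R I V c y ≤ max (V y) (value R I V c x + c) := by
  refine le_of_forall_pos_le_add fun δ hδ => ?_
  obtain ⟨t, ht, htδ⟩ := exists_lt_value_add h hδ
  refine value_le (.step hyx ht ?_ ?_)
  · linarith [le_max_left (V y) (value R I V c x + c)]
  · linarith [le_max_right (V y) (value R I V c x + c)]

lemma exists_value_le {δ : ℝ} (h : ∃ t, CostBound R I V c x t) (hx : x ∈ I) (hδ : 0 < δ) :
    ∃ y, R x y ∧ value R I V c y ≤ value R I V c x - c + δ := by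
  obtain ⟨t, ht, htδ⟩ := exists_lt_value_add h hδ
  cases ht with
  | base h1 h2 => exact absurd hx h1
  | @step _ y s _ h1 h2 h3 h4 => exact ⟨y, h1, by linarith [value_le h2]⟩

/-- `V` is discretely infinity superharmonic on `I`, with attained minima. -/
def Super (R : α → α → Prop) (I : Set α) (V : α → ℝ) : Prop :=
  ∀ x ∈ I, ∃ z, R x z ∧ (∀ y, R x y → V z ≤ V y) ∧ ∀ y, R x y → V z + V y ≤ 2 * V x

/-- Along a path of steepest descent the drop of `V` per step does not decrease. -/
lemma of_descent (hsymm : ∀ x y, R x y → R y x) (hV : Super R I V) {m : ℝ} (hm : ∀ x, m ≤ V x)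
    {μ : ℝ} (hμ : 0 < μ) {x z : α} (hxz : R x z) (hz : V z ≤ V x - μ) :
    ∃ k : ℕ, ∀ c, CostBound R I V c z (V z + k * max 0 (c - μ)) := by
  obtain ⟨N, hN⟩ := exists_nat_ge ((V x - m) / μ)
  rw [div_le_iff₀ hμ] at hN
  induction N generalizing x z with
  | zero =>
    have := hm z
    simp at hN
    linarith
  | succ N ih =>
    by_cases hzI : z ∈ I
    · obtain ⟨z', hzz', -, hz'⟩ := hV z hzI
      have h1 := hz' x (hsymm _ _ hxz)
      obtain ⟨k, hk⟩ := ih hzz' (by linarith) (by push_cast at hN; linarith)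
      refine ⟨k + 1, fun c => .step hzz' (hk c) ?_ ?_⟩
      · have : 0 ≤ ((k + 1 : ℕ) : ℝ) * max 0 (c - μ) := by positivity
        linarith
      · have := le_max_right 0 (c - μ)
        push_cast
        linarith
    · exact ⟨0, fun c => .base hzI (by simp)⟩

/-- Every point has a chain out of `I` along which `V` does not increase. -/
lemma exists_uniform (hsymm : ∀ x y, R x y → R y x) (hV : Super R I V) {m : ℝ}
    (hm : ∀ x, m ≤ V x) {b : α} (hb : b ∉ I) (hxb : Relation.ReflTransGen R x b) :
    ∃ k : ℕ, ∀ c, 0 < c → CostBound R I V c x (V x + k * c) := by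
  induction hxb using Relation.ReflTransGen.head_induction_on with
  | refl => exact ⟨0, fun c _ => .base hb (by simp)⟩
  | @head x y hxy _ ih =>
    by_cases hx : x ∈ I
    · obtain ⟨z, hxz, hmin, hz⟩ := hV x hx
      by_cases hlt : V z < V x
      · obtain ⟨k, hk⟩ := of_descent hsymm hV hm (sub_pos.2 hlt) hxz (by linarith)
        refine ⟨k + 1, fun c hc => .step hxz (hk c) ?_ ?_⟩
        · have : 0 ≤ ((k + 1 : ℕ) : ℝ) * c := by positivity
          linarith
        · have : (k : ℝ) * max 0 (c - (V x - V z)) ≤ k * c := by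
            gcongr
            exact max_le hc.le (by linarith)
          push_cast
          linarith
      · obtain ⟨k, hk⟩ := ih
        have h1 := hz y hxy
        have h2 := hmin y hxy
        refine ⟨k + 1, fun c hc => .step hxy (hk c hc) ?_ ?_⟩
        · have : 0 ≤ ((k + 1 : ℕ) : ℝ) * c := by positivity
          linarith
        · push_cast
          linarith
    · exact ⟨0, fun c _ => .base hx (by simp)⟩

/-- `value` is discretely infinity superharmonic with slope at least `c`. -/
lemma value_super (hsymm : ∀ x y, R x y → R y x) (hV : Super R I V) {m : ℝ}
    (hm : ∀ x, m ≤ V x) (hc : 0 < c) (hne : ∀ x, ∃ t, CostBound R I V c x t) (hx : x ∈ I)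
    (hxy : R x y) {δ : ℝ} (hδ : 0 < δ) :
    ∃ z, R x z ∧ value R I V c z + value R I V c y ≤ 2 * value R I V c x + δ := by
  by_cases h : value R I V c y ≤ value R I V c x + c
  · obtain ⟨z, hxz, hz⟩ := exists_value_le (hne x) hx hδ
    exact ⟨z, hxz, by linarith⟩
  · push Not at h
    have h1 : value R I V c y ≤ V y := by
      rcases le_max_iff.1 (value_le_max (hne x) (hsymm _ _ hxy)) with h' | h'
      · exact h'
      · linarith
    have h2 := le_value (hne x)
    obtain ⟨z, hxz, -, hz⟩ := hV x hx
    have h3 := hz y hxy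
    obtain ⟨k, hk⟩ := of_descent hsymm hV hm hc hxz (by linarith)
    have h4 := value_le (hk c)
    simp only [sub_self, max_self, mul_zero, add_zero] at h4
    exact ⟨z, hxz, by linarith⟩

/-- Comparison principle for discretely infinity sub- and superharmonic functions. -/
theorem comparison (hsymm : ∀ x y, R x y → R y x) {U : α → ℝ}
    (hU : ∀ x ∈ I, ∃ z, R x z ∧ ∀ y, R x y → 2 * U x ≤ U z + U y) (hV : Super R I V)
    {M m : ℝ} (hM : ∀ x, U x ≤ M) (hm : ∀ x, m ≤ V x)
    (hconn : ∀ x, ∃ b ∉ I, Relation.ReflTransGen R x b)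
    (hbdry : ∀ x ∉ I, U x ≤ V x) (x : α) : U x ≤ V x := by
  have hchain : ∀ x, ∃ k : ℕ, ∀ c, 0 < c → CostBound R I V c x (V x + k * c) := fun x => by
    obtain ⟨b, hb, hxb⟩ := hconn x
    exact exists_uniform hsymm hV hm hb hxb
  suffices key : ∀ c, 0 < c → ∀ x, U x ≤ value R I V c x by
    obtain ⟨k, hk⟩ := hchain x
    refine le_of_forall_pos_le_add fun δ hδ => ?_
    have hc : 0 < δ / (k + 1) := by positivity
    refine (key _ hc x).trans ((value_le (hk _ hc)).trans ?_)
    have : (k : ℝ) * (δ / (k + 1)) ≤ δ := by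
      rw [mul_div_assoc', div_le_iff₀ (by positivity)]
      linarith
    linarith
  intro c hc x₀
  have hne : ∀ x, ∃ t, CostBound R I V c x t := fun x => by
    obtain ⟨k, hk⟩ := hchain x
    exact ⟨_, hk c hc⟩
  set w := value R I V c with hw
  have hVw : ∀ x, V x ≤ w x := fun x => le_value (hne x)
  by_contra! hx₀
  have hbdd : BddAbove (range fun x => U x - w x) := by
    refine ⟨M - m, ?_⟩
    rintro _ ⟨x, rfl⟩
    simp only
    linarith [hM x, hm x, hVw x]
  set s := ⨆ x, (U x - w x) with hs
  have hsle : ∀ x, U x - w x ≤ s := fun x => le_ciSup hbdd x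
  have hspos : 0 < s := lt_of_lt_of_le (sub_pos.2 hx₀) (hsle x₀)
  have climb : ∀ N : ℕ, ∀ δ : ℝ, 0 < δ → 3 ^ N * δ ≤ c / 4 → 3 ^ N * δ ≤ s / 2 →
      ∀ x, s - δ ≤ U x - w x → U x ≤ M - N * (c / 2) := by
    intro N
    induction N with
    | zero => intro δ _ _ _ x _; simpa using hM x
    | succ N ih =>
      intro δ hδ h1 h2 x hx
      have hpow : δ ≤ 3 ^ (N + 1) * δ := le_mul_of_one_le_left hδ.le (one_le_pow₀ (by norm_num))
      have hxI : x ∈ I := by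
        by_contra hxI
        linarith [hbdry x hxI, hVw x]
      obtain ⟨z, hxz, hz⟩ := hU x hxI
      obtain ⟨y, hxy, hy⟩ := exists_value_le (hne x) hxI hδ
      obtain ⟨y', hxy', hy'⟩ := value_super hsymm hV hm hc hne hxI hxz hδ
      rw [← hw] at hy hy'
      have h3 := ih (3 * δ) (by positivity) (by rw [pow_succ] at h1; linarith)
        (by rw [pow_succ] at h2; linarith) z (by linarith [hz y' hxy', hsle y'])
      push_cast
      linarith [hz y hxy, hsle y]
  obtain ⟨N, hN⟩ := exists_nat_gt ((M - m) / (c / 2))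
  rw [div_lt_iff₀ (by positivity)] at hN
  have h3 : (0 : ℝ) < 3 ^ N := by positivity
  have hδ : 0 < min (c / 4) (s / 2) / 3 ^ N := by positivity
  have hmul : 3 ^ N * (min (c / 4) (s / 2) / 3 ^ N) = min (c / 4) (s / 2) := by field_simp
  have : Nonempty α := ⟨x₀⟩
  obtain ⟨x, hx⟩ := exists_lt_of_lt_ciSup
    (show s - min (min (c / 4) (s / 2) / 3 ^ N) s < s by
      linarith [lt_min hδ hspos])
  have := climb N _ hδ (hmul.le.trans (min_le_left _ _)) (hmul.le.trans (min_le_right _ _)) x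
    (by linarith [min_le_left (min (c / 4) (s / 2) / 3 ^ N) s])
  linarith [hm x, hVw x, min_le_right (min (c / 4) (s / 2) / 3 ^ N) s]

end CostBound

/-- A preconnected set meeting a set and its complement meets the frontier of that set. -/
lemma IsPreconnected.inter_frontier_nonempty_of_inter {X : Type*} [TopologicalSpace X]
    {s t : Set X} (ht : IsPreconnected t) (h1 : (t ∩ s).Nonempty) (h2 : (t ∩ sᶜ).Nonempty) :
    (t ∩ frontier s).Nonempty := by
  by_contra h
  have hfr : ∀ x ∈ t, x ∈ closure s → x ∈ interior s := fun x hx hxc => by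
    by_contra hxi
    exact h ⟨x, hx, hxc, hxi⟩
  obtain ⟨p, hpt, hps⟩ := h1
  obtain ⟨q, hqt, hqs⟩ := h2
  obtain ⟨z, -, hz1, hz2⟩ := ht (interior s) (closure s)ᶜ isOpen_interior
    isClosed_closure.isOpen_compl
    (fun x hx => (em (x ∈ closure s)).imp (hfr x hx) id)
    ⟨p, hpt, hfr p hpt (subset_closure hps)⟩
    ⟨q, hqt, fun hq => hqs (interior_subset (hfr q hqt hq))⟩
  exact hz2 (interior_subset_closure hz1)

section Euclidean

variable {n : ℕ}

lemma CmpBelow.neg {Ω : Set (Euc n)} {u : Euc n → ℝ} (h : CmpBelow Ω u) :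
    CmpAbove Ω (-u) := by
  intro V hV hVb hVΩ x₀ a b hle x hx
  have := h V hV hVb hVΩ x₀ (-a) (-b)
    (fun y hy => by have := hle y hy; simp only [Pi.neg_apply] at this; linarith) x hx
  simp only [Pi.neg_apply]
  linarith

/-- The cone comparison on a ball centred at the vertex. -/
lemma CmpAbove.two_mul_le {Ω : Set (Euc n)} {u : Euc n → ℝ} (h : CmpAbove Ω u) {x p : Euc n}
    {ε K : ℝ} (hε : 0 < ε) (hΩ : closedBall x (2 * ε) ⊆ Ω)
    (hK : ∀ y ∈ closedBall x (2 * ε), u y ≤ K) (hp : p ∈ closedBall x ε) :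
    2 * u p ≤ K + u x := by
  have hxK : u x ≤ K := hK x (mem_closedBall_self (by positivity))
  have hmem : p ∈ ball x (2 * ε) := closedBall_subset_ball (by linarith) hp
  have := h (ball x (2 * ε)) isOpen_ball isBounded_ball
    (closure_ball_subset_closedBall.trans hΩ) x ((K - u x) / (2 * ε)) (u x) ?_ p hmem
  · rw [mem_closedBall, dist_eq_norm] at hp
    have h2 : (K - u x) / (2 * ε) * ‖p - x‖ ≤ (K - u x) / (2 * ε) * ε :=
      mul_le_mul_of_nonneg_left hp (div_nonneg (by linarith) (by positivity))
    have h3 : (K - u x) / (2 * ε) * ε = (K - u x) / 2 := by field_simp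
    linarith
  · intro y hy
    have hopen : IsOpen (ball x (2 * ε) \ {x}) := isOpen_ball.sdiff isClosed_singleton
    rw [hopen.frontier_eq] at hy
    have hyc : y ∈ closedBall x (2 * ε) :=
      closure_ball_subset_closedBall (closure_mono sdiff_subset hy.1)
    by_cases hyx : y = x
    · simp [hyx]
    · have hyd : 2 * ε ≤ ‖y - x‖ := by
        by_contra! hlt
        exact hy.2 ⟨by rwa [mem_ball, dist_eq_norm], hyx⟩
      have h1 : (K - u x) / (2 * ε) * (2 * ε) ≤ (K - u x) / (2 * ε) * ‖y - x‖ :=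
        mul_le_mul_of_nonneg_left hyd (div_nonneg (by linarith) (by positivity))
      have h2 : (K - u x) / (2 * ε) * (2 * ε) = K - u x := by field_simp
      linarith [hK y hyc]

/-- Taking maxima over `ε`-balls turns an infinity subharmonic function into a discretely
infinity subharmonic one. -/
lemma CmpAbove.exists_ballMax {Ω : Set (Euc n)} {u : Euc n → ℝ} (h : CmpAbove Ω u)
    (hu : ContinuousOn u Ω) {ε : ℝ} (hε : 0 < ε) :
    ∃ U : {x : Euc n // closedBall x ε ⊆ Ω} → ℝ,
      (∀ x, ∃ p ∈ closedBall x.1 ε, U x = u p) ∧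
      (∀ x, ∀ p ∈ closedBall x.1 ε, u p ≤ U x) ∧
      ∀ x, closedBall x.1 (2 * ε) ⊆ Ω → ∃ z, dist x.1 z.1 ≤ ε ∧
        (∀ y, dist x.1 y.1 ≤ ε → U y ≤ U z) ∧
        ∀ y, dist x.1 y.1 ≤ ε → 2 * U x ≤ U z + U y := by
  have hmax : ∀ x : {x : Euc n // closedBall x ε ⊆ Ω}, ∃ p ∈ closedBall x.1 ε,
      IsMaxOn u (closedBall x.1 ε) p := fun x =>
    (isCompact_closedBall x.1 ε).exists_isMaxOn ⟨x.1, mem_closedBall_self hε.le⟩ (hu.mono x.2)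
  choose p hp hpmax using hmax
  refine ⟨fun x => u (p x), fun x => ⟨p x, hp x, rfl⟩, fun x q hq => hpmax x hq,
    fun x hx => ?_⟩
  obtain ⟨q, hq, hqmax⟩ := (isCompact_closedBall x.1 (2 * ε)).exists_isMaxOn
    ⟨x.1, mem_closedBall_self (by positivity)⟩ (hu.mono hx)
  have hsub : ∀ y : Euc n, dist x.1 y ≤ ε → closedBall y ε ⊆ closedBall x.1 (2 * ε) :=
    fun y hy => closedBall_subset_closedBall' (by rw [dist_comm]; linarith)
  rw [mem_closedBall, dist_comm] at hq
  have hz1 : dist x.1 (midpoint ℝ x.1 q) ≤ ε := by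
    rw [dist_left_midpoint]
    norm_num
    linarith
  have hz2 : dist q (midpoint ℝ x.1 q) ≤ ε := by
    rw [dist_right_midpoint]
    norm_num
    linarith
  have hqz := hpmax ⟨midpoint ℝ x.1 q, (hsub _ hz1).trans hx⟩ (mem_closedBall.2 hz2)
  refine ⟨⟨midpoint ℝ x.1 q, (hsub _ hz1).trans hx⟩, hz1, fun y hy => ?_, fun y hy => ?_⟩
  · exact (hqmax (hsub _ hy (hp y))).trans hqz
  · have h1 : u x.1 ≤ u (p y) := hpmax y (mem_closedBall.2 hy)
    have h2 := h.two_mul_le hε hx (fun y hy => hqmax hy) (hp x)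
    exact h2.trans (add_le_add hqz h1)

/-- A continuous function is uniformly close to its boundary values near the boundary. -/
lemma exists_near_frontier {A : Set (Euc n)} (hAcl : IsClosed A) (hA1 : A ⊆ ball 0 1)
    {u : Euc n → ℝ} (hu : ContinuousOn u (closure Aᶜ)) {κ : ℝ} (hκ : 0 < κ) :
    ∃ δ > 0, ∀ b ∈ frontier Aᶜ, ∀ p ∈ Aᶜ, dist p b < δ → |u p - u b| < κ := by
  have hK : IsCompact (closure Aᶜ ∩ closedBall (0 : Euc n) 2) :=
    (isCompact_closedBall _ _).inter_left isClosed_closure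
  have hunif := hK.uniformContinuousOn_of_continuous (hu.mono inter_subset_left)
  obtain ⟨δ, hδ, h⟩ := Metric.uniformContinuousOn_iff.1 hunif κ hκ
  refine ⟨min δ 1, by positivity, fun b hb p hp hpb => ?_⟩
  have hbA : b ∈ ball (0 : Euc n) 1 := by
    rw [frontier_compl] at hb
    exact hA1 (hAcl.frontier_subset hb)
  rw [mem_ball] at hbA
  refine h p ⟨subset_closure hp, ?_⟩ b ⟨frontier_subset_closure hb, ?_⟩
    (hpb.trans_le (min_le_left _ _))
  · rw [mem_closedBall]
    linarith [dist_triangle p b 0, hpb.trans_le (min_le_right δ 1)]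
  · rw [mem_closedBall]
    linarith

lemma exists_dist_le_norm_eq_sub {E : Type*} [NormedAddCommGroup E] [NormedSpace ℝ E] {x : E}
    {ε : ℝ} (hε : 0 ≤ ε) (hx : ε < ‖x‖) : ∃ y, dist x y ≤ ε ∧ ‖y‖ = ‖x‖ - ε := by
  have hpos : 0 < ‖x‖ := hε.trans_lt hx
  refine ⟨(1 - ε / ‖x‖) • x, ?_, ?_⟩
  · rw [dist_eq_norm, sub_smul, one_smul, sub_sub_cancel, norm_smul,
      Real.norm_of_nonneg (by positivity), div_mul_cancel₀ _ hpos.ne']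
  · have h1 : 0 ≤ 1 - ε / ‖x‖ := by
      rw [sub_nonneg, div_le_one hpos]
      exact hx.le
    rw [norm_smul, Real.norm_of_nonneg h1, sub_mul, one_mul, div_mul_cancel₀ _ hpos.ne']

/-- Each point is joined by an `ε`-chain, directed towards the origin, to the boundary layer. -/
lemma exists_chain {A : Set (Euc n)} (h0A : (0 : Euc n) ∈ A) {ε : ℝ} (hε : 0 < ε)
    (x : {x : Euc n // closedBall x ε ⊆ Aᶜ}) :
    ∃ b ∉ {y : {x : Euc n // closedBall x ε ⊆ Aᶜ} | closedBall y.1 (2 * ε) ⊆ Aᶜ},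
      Relation.ReflTransGen (fun y z => dist y.1 z.1 ≤ ε) x b := by
  obtain ⟨N, hN⟩ := exists_nat_ge (‖x.1‖ / ε)
  rw [div_le_iff₀ hε] at hN
  induction N generalizing x with
  | zero =>
    refine ⟨x, fun hx => hx ?_ h0A, .refl⟩
    simp only [Nat.cast_zero, zero_mul] at hN
    rw [mem_closedBall, dist_comm, dist_zero_right]
    linarith
  | succ N ih =>
    by_cases hx : closedBall x.1 (2 * ε) ⊆ Aᶜ
    · have hnorm : 2 * ε < ‖x.1‖ := by
        by_contra! hle
        refine hx ?_ h0A
        rwa [mem_closedBall, dist_comm, dist_zero_right]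
      obtain ⟨y, hdist, hyN⟩ := exists_dist_le_norm_eq_sub hε.le (by linarith : ε < ‖x.1‖)
      have hball : ε + dist y x.1 ≤ 2 * ε := by
        rw [dist_comm]
        linarith
      have hy : closedBall y ε ⊆ Aᶜ := (closedBall_subset_closedBall' hball).trans hx
      have hyN' : ‖y‖ ≤ N * ε := by
        push_cast at hN
        linarith
      obtain ⟨b, hb, hyb⟩ := ih ⟨y, hy⟩ hyN'
      refine ⟨b, hb, .head ?_ hyb⟩
      exact hdist
    · exact ⟨x, hx, .refl⟩

/-- One half of the uniqueness: comparison for bounded functions in an exterior domain. -/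
theorem le_of_cmpAbove_of_cmpBelow {A : Set (Euc n)} (hAcl : IsClosed A)
    (h0A : (0 : Euc n) ∈ A) (hA1 : A ⊆ ball 0 1) {u v : Euc n → ℝ}
    (hu : ContinuousOn u (closure Aᶜ)) (hv : ContinuousOn v (closure Aᶜ))
    (hcu : CmpAbove Aᶜ u) (hcv : CmpBelow Aᶜ v) (hle : ∀ x ∈ frontier Aᶜ, u x ≤ v x)
    {M m : ℝ} (hM : ∀ x ∈ Aᶜ, u x ≤ M) (hm : ∀ x ∈ Aᶜ, m ≤ v x) {x : Euc n} (hx : x ∈ Aᶜ) :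
    u x ≤ v x := by
  refine le_of_forall_pos_le_add fun κ hκ => ?_
  obtain ⟨δ₁, hδ₁, h₁⟩ := exists_near_frontier hAcl hA1 hu (half_pos hκ)
  obtain ⟨δ₂, hδ₂, h₂⟩ := exists_near_frontier hAcl hA1 hv (half_pos hκ)
  obtain ⟨r, hr, hrA⟩ := Metric.nhds_basis_closedBall.mem_iff.1 (hAcl.isOpen_compl.mem_nhds hx)
  obtain ⟨ε, hε, hεlt⟩ : ∃ ε > 0, ε < min r (min (δ₁ / 5) (δ₂ / 5)) :=
    exists_between (by positivity)
  simp only [lt_min_iff] at hεlt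
  obtain ⟨hεr, hε₁, hε₂⟩ := hεlt
  obtain ⟨U, hUp, hUle, hUsub⟩ := hcu.exists_ballMax (hu.mono subset_closure) hε
  obtain ⟨W, hWp, hWle, hWsub⟩ := hcv.neg.exists_ballMax (hv.mono subset_closure).neg hε
  have hxε : closedBall x ε ⊆ Aᶜ := (closedBall_subset_closedBall hεr.le).trans hrA
  have main := CostBound.comparison
    (R := fun y z : {x : Euc n // closedBall x ε ⊆ Aᶜ} => dist y.1 z.1 ≤ ε)
    (I := {y | closedBall y.1 (2 * ε) ⊆ Aᶜ}) (U := U) (V := fun y => κ - W y) (M := M)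
    (m := κ + m) (fun y z hyz => by rwa [dist_comm])
    (fun y hy => (hUsub y hy).imp fun z hz => ⟨hz.1, hz.2.2⟩)
    (fun y hy => (hWsub y hy).imp fun z hz => ⟨hz.1,
      fun y' hy' => by linarith [hz.2.1 y' hy'], fun y' hy' => by linarith [hz.2.2 y' hy']⟩)
    (fun y => by
      obtain ⟨p, hp, hpy⟩ := hUp y
      exact hpy ▸ hM p (y.2 hp))
    (fun y => by
      obtain ⟨q, hq, hqy⟩ := hWp y
      have := hm q (y.2 hq)
      simp only [Pi.neg_apply] at hqy
      linarith)
    (exists_chain h0A hε)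
    (fun y hy => by
      obtain ⟨p, hp, hpy⟩ := hUp y
      obtain ⟨q, hq, hqy⟩ := hWp y
      obtain ⟨a, hay, haA⟩ := Set.not_subset.1 hy
      rw [mem_compl_iff, not_not] at haA
      obtain ⟨b, hb, hbA⟩ := (convex_segment y.1 a).isPreconnected.inter_frontier_nonempty_of_inter
        (s := Aᶜ) ⟨y.1, left_mem_segment ℝ _ _, y.2 (mem_closedBall_self hε.le)⟩
        ⟨a, right_mem_segment ℝ _ _, by simpa using haA⟩
      have hby : dist b y.1 ≤ 2 * ε := (convex_closedBall y.1 (2 * ε)).segment_subset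
        (mem_closedBall_self (by positivity)) hay hb
      rw [dist_comm] at hby
      rw [mem_closedBall] at hp hq
      have hup := h₁ b hbA p (y.2 hp) (by linarith [dist_triangle p y.1 b])
      have hvq := h₂ b hbA q (y.2 hq) (by linarith [dist_triangle q y.1 b])
      simp only [Pi.neg_apply] at hqy
      rw [abs_lt] at hup hvq
      linarith [hle b hbA, hup.2, hvq.1])
    ⟨x, hxε⟩
  have hux := hUle ⟨x, hxε⟩ x (mem_closedBall_self hε.le)
  have hvx := hWle ⟨x, hxε⟩ x (mem_closedBall_self hε.le)
  simp only [Pi.neg_apply] at hvx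
  linarith

end Euclidean

/-- Theorem 2(i), uniqueness for λ = 0: a bounded-between-boundary-extrema
exterior infinity harmonic extension of g is unique. -/
theorem stmt13 {n : ℕ} (A : Set (Euc n)) (hAcl : IsClosed A) (hAbd : IsBounded A)
    (h0A : (0 : Euc n) ∈ A) (hA1 : A ⊆ ball 0 1)
    (g : Euc n → ℝ) (hg : ContinuousOn g (frontier Aᶜ))
    (u v : Euc n → ℝ)
    (hu : ContinuousOn u (closure Aᶜ)) (hv : ContinuousOn v (closure Aᶜ))
    (hIHu : InfHarmonic Aᶜ u) (hIHv : InfHarmonic Aᶜ v)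
    (hbu : ∀ x ∈ frontier Aᶜ, u x = g x) (hbv : ∀ x ∈ frontier Aᶜ, v x = g x)
    (hboundu : ∀ x ∈ Aᶜ, sInf (g '' frontier Aᶜ) ≤ u x ∧ u x ≤ sSup (g '' frontier Aᶜ))
    (hboundv : ∀ x ∈ Aᶜ, sInf (g '' frontier Aᶜ) ≤ v x ∧ v x ≤ sSup (g '' frontier Aᶜ)) :
    ∀ x ∈ Aᶜ, u x = v x := by
  intro x hx
  exact le_antisymm
    (le_of_cmpAbove_of_cmpBelow hAcl h0A hA1 hu hv hIHu.1 hIHv.2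
      (fun y hy => ((hbu y hy).trans (hbv y hy).symm).le)
      (fun y hy => (hboundu y hy).2) (fun y hy => (hboundv y hy).1) hx)
    (le_of_cmpAbove_of_cmpBelow hAcl h0A hA1 hv hu hIHv.1 hIHu.2
      (fun y hy => ((hbv y hy).trans (hbu y hy).symm).le)
      (fun y hy => (hboundv y hy).2) (fun y hy => (hboundu y hy).1) hx)
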